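/- For any good sequence of (n,R_n) coordination codes for P_{Y|X}, it holds that lim_{n→∞} (1/n) D(P_{Y^n} ‖ Q_{Y^n}) = 0, where P_{Y^n} is the distribution of Y^n = g_n(f_n(X^n)) under the i.i.d. source P_X and Q_{Y^n}(y^n) = |g_n^{-1}(y^n)|/M is the uniform distribution over the codebook. -/

import Mathlib

open scoped BigOperators ENNReal Classical
open Filter

section InformationDefs

variable {α X Y : Type*}

/-- A probability mass function on a finite alphabet. -/
def IsPMF [Fintype α] (P : α → ℝ) : Prop :=
  (∀ a, 0 ≤ P a) ∧ ∑ a, P a = 1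

/-- Variational distance `‖P − Q‖ = sup_A |P(A) − Q(A)|` on a finite alphabet. -/
noncomputable def tvDist [Fintype α] (P Q : α → ℝ) : ℝ :=
  Finset.univ.powerset.sup' ⟨∅, Finset.empty_mem_powerset _⟩
    fun A => |∑ a ∈ A, P a - ∑ a ∈ A, Q a|

/-- Relative entropy `D(P‖Q) = ∑ P log(P/Q)` on a finite alphabet, infinite when
`P` is not absolutely continuous with respect to `Q`. -/
noncomputable def relEnt [Fintype α] (P Q : α → ℝ) : ℝ≥0∞ :=
  if ∀ a, Q a = 0 → P a = 0 then
    ENNReal.ofReal (∑ a, P a * Real.log (P a / Q a))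
  else ⊤

/-- Shannon entropy on a finite alphabet. -/
noncomputable def entropy [Fintype α] (P : α → ℝ) : ℝ :=
  -∑ a, P a * Real.log (P a)

/-- First (X-) marginal of a joint distribution. -/
noncomputable def margX [Fintype Y] (P : X × Y → ℝ) : X → ℝ :=
  fun x => ∑ y, P (x, y)

/-- Second (Y-) marginal of a joint distribution. -/
noncomputable def margY [Fintype X] (P : X × Y → ℝ) : Y → ℝ :=
  fun y => ∑ x, P (x, y)

/-- Backward conditional distribution `P_{X|Y}(x|y) = P(x,y)/P_Y(y)`. -/
noncomputable def condXY [Fintype X] (P : X × Y → ℝ) : X → Y → ℝ :=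
  fun x y => P (x, y) / margY P y

/-- Forward conditional distribution `P_{Y|X}(y|x) = P(x,y)/P_X(x)`. -/
noncomputable def condYX [Fintype Y] (P : X × Y → ℝ) : Y → X → ℝ :=
  fun y x => P (x, y) / margX P x

/-- Mutual information `I(X;Y)` of a joint distribution on a finite product alphabet. -/
noncomputable def mutualInfo [Fintype X] [Fintype Y] (P : X × Y → ℝ) : ℝ :=
  ∑ x, ∑ y, P (x, y) * Real.log (P (x, y) / (margX P x * margY P y))

/-- A block code of length `n`: an encoder into `{1,…,M}` and a decoder. -/
structure Code (X Y : Type*) (n : ℕ) where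
  M : ℕ
  hM : 0 < M
  enc : (Fin n → X) → Fin M
  dec : Fin M → Fin n → Y

/-- Rate `R_n = (1/n) log M` of a code. -/
noncomputable def Code.rate {X Y : Type*} {n : ℕ} (c : Code X Y n) : ℝ :=
  Real.log c.M / n

/-- The reconstruction sequence `Yⁿ = g_n(f_n(xⁿ))` produced by a code. -/
def Code.out {X Y : Type*} {n : ℕ} (c : Code X Y n) (xs : Fin n → X) : Fin n → Y :=
  c.dec (c.enc xs)

/-- The i.i.d. (memoryless) source distribution on `n`-blocks. -/
noncomputable def iid (PX : X → ℝ) (n : ℕ) : (Fin n → X) → ℝ :=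
  fun xs => ∏ i, PX (xs i)

/-- The code-induced joint distribution
`P_{XⁿYⁿ}(xⁿ,yⁿ) = ∏ P_X(x_i) · 1{yⁿ = g_n(f_n(xⁿ))}`. -/
noncomputable def inducedJoint [DecidableEq Y] (PX : X → ℝ) {n : ℕ} (c : Code X Y n) :
    (Fin n → X) × (Fin n → Y) → ℝ :=
  fun p => (∏ i, PX (p.1 i)) * (if p.2 = c.out p.1 then 1 else 0)

/-- The approximating joint distribution
`Q_{XⁿYⁿ}(xⁿ,yⁿ) = (|g_n⁻¹(yⁿ)|/M) · ∏ P_{X|Y}(x_i|y_i)`: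
a uniformly chosen codeword passed through the backward memoryless channel. -/
noncomputable def approxJoint [Fintype X] [DecidableEq Y] (PXY : X × Y → ℝ) {n : ℕ}
    (c : Code X Y n) : (Fin n → X) × (Fin n → Y) → ℝ :=
  fun p => (((Finset.univ.filter fun m => c.dec m = p.2).card : ℝ) / c.M) *
    ∏ i, condXY PXY (p.1 i) (p.2 i)

/-- The uniform distribution over the codebook, `Q_{Yⁿ}(yⁿ) = |g_n⁻¹(yⁿ)|/M`. -/
noncomputable def codebookUniform [DecidableEq Y] {n : ℕ} (c : Code X Y n) :
    (Fin n → Y) → ℝ :=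
  fun ys => ((Finset.univ.filter fun m => c.dec m = ys).card : ℝ) / c.M

/-- The empirical (joint type) distribution of a pair of sequences. -/
noncomputable def empDist [DecidableEq X] [DecidableEq Y] {n : ℕ}
    (xs : Fin n → X) (ys : Fin n → Y) : X × Y → ℝ :=
  fun p => ((Finset.univ.filter fun i => xs i = p.1 ∧ ys i = p.2).card : ℝ) / n

/-- `‖T_{XⁿYⁿ} − P_{XY}‖ → 0` in probability under the i.i.d. source. -/
def TVInProb [Fintype X] [Fintype Y] [DecidableEq X] [DecidableEq Y]
    (PX : X → ℝ) (PXY : X × Y → ℝ) (c : ∀ n, Code X Y n) : Prop :=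
  ∀ ε : ℝ, 0 < ε →
    Tendsto (fun n => ∑ xs : Fin n → X,
        if ε < tvDist (empDist xs ((c n).out xs)) PXY then iid PX n xs else 0)
      atTop (nhds 0)

/-- A good sequence of coordination codes for `P_{Y|X}` (specified via the joint `PXY`):
the rates converge to `I(X;Y)` and the empirical distribution converges to `PXY`
in variational distance, in probability. -/
def GoodCoord [Fintype X] [Fintype Y] [DecidableEq X] [DecidableEq Y]
    (PX : X → ℝ) (PXY : X × Y → ℝ) (c : ∀ n, Code X Y n) : Prop :=
  Tendsto (fun n => (c n).rate) atTop (nhds (mutualInfo PXY)) ∧ TVInProb PX PXY c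

end InformationDefs
section OutputRelativeEntropy

variable {X Y : Type*}

theorem Code.codebookUniform_out_ge [DecidableEq Y] {n : ℕ} (c : Code X Y n) (xs : Fin n → X) :
    1 / (c.M : ℝ) ≤ codebookUniform c (c.out xs) := by
  unfold codebookUniform
  gcongr
  rw [Nat.one_le_cast, Nat.one_le_iff_ne_zero, Finset.card_ne_zero]
  exact ⟨c.enc xs, Finset.mem_filter.mpr ⟨Finset.mem_univ _, rfl⟩⟩

theorem iid_pos {PX : X → ℝ} (hpos : ∀ x, 0 < PX x) {n : ℕ} (xs : Fin n → X) :
    0 < iid PX n xs :=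
  Finset.prod_pos fun _ _ => hpos _

theorem sum_iid [Fintype X] {PX : X → ℝ} (hPX : IsPMF PX) (n : ℕ) :
    ∑ xs, iid PX n xs = 1 := by
  unfold iid
  rw [← Fintype.prod_sum fun (_ : Fin n) => PX]
  simp [hPX.2]

theorem iid_le_margY_inducedJoint [Fintype X] [DecidableEq Y] {PX : X → ℝ}
    (hpos : ∀ x, 0 < PX x) {n : ℕ} (c : Code X Y n) (xs : Fin n → X) :
    iid PX n xs ≤ margY (inducedJoint PX c) (c.out xs) := by
  have h : ∀ zs ∈ Finset.univ, 0 ≤ inducedJoint PX c (zs, c.out xs) := fun zs _ =>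
    mul_nonneg (iid_pos hpos zs).le (by split_ifs <;> norm_num)
  have := Finset.single_le_sum h (Finset.mem_univ xs)
  simpa [margY, inducedJoint, iid] using this

theorem sum_margY_inducedJoint_mul [Fintype X] [Fintype Y] [DecidableEq Y] (PX : X → ℝ) {n : ℕ}
    (c : Code X Y n) (f : (Fin n → Y) → ℝ) :
    ∑ ys, margY (inducedJoint PX c) ys * f ys = ∑ xs, iid PX n xs * f (c.out xs) := by
  simp only [margY, Finset.sum_mul]
  rw [Finset.sum_comm]
  refine Finset.sum_congr rfl fun xs _ => ?_
  rw [Finset.sum_eq_single (c.out xs)]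
  · simp [inducedJoint, iid]
  · intro ys _ h
    simp [inducedJoint, h]
  · simp

/-- The output law of a code is absolutely continuous with respect to the codebook law. -/
theorem relEnt_output_eq_ofReal [Fintype X] [Fintype Y] [DecidableEq Y] (PX : X → ℝ) {n : ℕ}
    (c : Code X Y n) :
    relEnt (margY (inducedJoint PX c)) (codebookUniform c) =
      ENNReal.ofReal (∑ xs, iid PX n xs * Real.log
        (margY (inducedJoint PX c) (c.out xs) / codebookUniform c (c.out xs))) := by
  rw [relEnt, if_pos, sum_margY_inducedJoint_mul PX c fun ys =>
    Real.log (margY (inducedJoint PX c) ys / codebookUniform c ys)]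
  intro ys h
  refine Finset.sum_eq_zero fun xs _ => ?_
  have hne : ys ≠ c.out xs := by
    rintro rfl
    have hM : (0 : ℝ) < c.M := by exact_mod_cast c.hM
    have := c.codebookUniform_out_ge xs
    rw [h] at this
    exact absurd this (not_le.mpr (by positivity))
  simp [inducedJoint, hne]

/-- Gibbs' inequality for the posterior of the source block given the output block, against a
positive subnormalized memoryless backward channel `V`. -/
theorem sum_iid_mul_log_output_le [Fintype X] [Fintype Y] [DecidableEq Y] {PX : X → ℝ}
    (hPX : IsPMF PX) (hpos : ∀ x, 0 < PX x) {V : X → Y → ℝ} (hV : ∀ x y, 0 < V x y)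
    (hVsum : ∀ y, ∑ x, V x y ≤ 1) {n : ℕ} (c : Code X Y n) :
    ∑ xs, iid PX n xs * Real.log (margY (inducedJoint PX c) (c.out xs)) ≤
      -∑ xs, iid PX n xs * ∑ i, Real.log (V (xs i) (c.out xs i) / PX (xs i)) := by
  set P := margY (inducedJoint PX c)
  have hPout : ∀ xs, 0 < P (c.out xs) := fun xs =>
    (iid_pos hpos xs).trans_le (iid_le_margY_inducedJoint hpos c xs)
  have hPnn : ∀ ys, 0 ≤ P ys := fun ys => Finset.sum_nonneg fun zs _ =>
    mul_nonneg (iid_pos hpos zs).le (by split_ifs <;> norm_num)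
  have hPsum : ∑ ys, P ys = 1 := by
    simpa [sum_iid hPX] using sum_margY_inducedJoint_mul PX c fun _ => 1
  have hterm : ∀ xs : Fin n → X,
      iid PX n xs * Real.log (P (c.out xs)) +
        iid PX n xs * ∑ i, Real.log (V (xs i) (c.out xs i) / PX (xs i)) ≤
      P (c.out xs) * ∏ i, V (xs i) (c.out xs i) - iid PX n xs := by
    intro xs
    have hp := iid_pos hpos xs
    have hq : 0 < ∏ i, V (xs i) (c.out xs i) := Finset.prod_pos fun _ _ => hV _ _
    rw [← Real.log_prod fun i _ => (div_pos (hV _ _) (hpos _)).ne', Finset.prod_div_distrib,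
      show ∏ i, PX (xs i) = iid PX n xs from rfl,
      ← mul_add, ← Real.log_mul (hPout xs).ne' (div_pos hq hp).ne']
    have hlog := Real.log_le_sub_one_of_pos (mul_pos (hPout xs) (div_pos hq hp))
    calc _ ≤ iid PX n xs * (P (c.out xs) * ((∏ i, V (xs i) (c.out xs i)) / iid PX n xs) - 1) :=
          mul_le_mul_of_nonneg_left hlog hp.le
      _ = _ := by field_simp
  have hsum : ∑ xs : Fin n → X, P (c.out xs) * ∏ i, V (xs i) (c.out xs i) ≤ 1 := by
    calc ∑ xs : Fin n → X, P (c.out xs) * ∏ i, V (xs i) (c.out xs i)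
        ≤ ∑ xs : Fin n → X, ∑ ys, P ys * ∏ i, V (xs i) (ys i) :=
          Finset.sum_le_sum fun xs _ => Finset.single_le_sum
            (f := fun ys => P ys * ∏ i, V (xs i) (ys i))
            (fun ys _ => mul_nonneg (hPnn ys) (Finset.prod_nonneg fun _ _ => (hV _ _).le))
            (Finset.mem_univ _)
      _ = ∑ ys, P ys * ∏ i, ∑ x, V x (ys i) := by
          rw [Finset.sum_comm]
          refine Finset.sum_congr rfl fun ys _ => ?_
          rw [← Finset.mul_sum, Fintype.prod_sum fun i x => V x (ys i)]
      _ ≤ ∑ ys, P ys * 1 := by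
          refine Finset.sum_le_sum fun ys _ => mul_le_mul_of_nonneg_left ?_ (hPnn ys)
          exact Finset.prod_le_one (fun i _ => Finset.sum_nonneg fun _ _ => (hV _ _).le)
            fun i _ => hVsum _
      _ = 1 := by simp [hPsum]
  have := Finset.sum_le_sum fun xs (_ : xs ∈ Finset.univ) => hterm xs
  rw [Finset.sum_add_distrib, Finset.sum_sub_distrib, sum_iid hPX] at this
  linarith

theorem sum_iid_mul_log_div_le [Fintype X] [Fintype Y] [DecidableEq Y] {PX : X → ℝ}
    (hPX : IsPMF PX) (hpos : ∀ x, 0 < PX x) {V : X → Y → ℝ} (hV : ∀ x y, 0 < V x y)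
    (hVsum : ∀ y, ∑ x, V x y ≤ 1) {n : ℕ} (c : Code X Y n) :
    ∑ xs, iid PX n xs * Real.log
        (margY (inducedJoint PX c) (c.out xs) / codebookUniform c (c.out xs)) ≤
      Real.log c.M -
        ∑ xs, iid PX n xs * ∑ i, Real.log (V (xs i) (c.out xs i) / PX (xs i)) := by
  have hM : (0 : ℝ) < c.M := by exact_mod_cast c.hM
  have hterm : ∀ xs : Fin n → X, iid PX n xs * Real.log
      (margY (inducedJoint PX c) (c.out xs) / codebookUniform c (c.out xs)) ≤
      iid PX n xs * Real.log c.M +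
        iid PX n xs * Real.log (margY (inducedJoint PX c) (c.out xs)) := by
    intro xs
    have hp := iid_pos hpos xs
    have hP := hp.trans_le (iid_le_margY_inducedJoint hpos c xs)
    have hQ := c.codebookUniform_out_ge xs
    have hQ0 : 0 < codebookUniform c (c.out xs) := lt_of_lt_of_le (by positivity) hQ
    rw [← mul_add]
    refine mul_le_mul_of_nonneg_left ?_ hp.le
    rw [Real.log_div hP.ne' hQ0.ne']
    have := Real.log_le_log (by positivity) hQ
    rw [one_div, Real.log_inv] at this
    linarith
  have h := Finset.sum_le_sum fun xs (_ : xs ∈ Finset.univ) => hterm xs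
  rw [Finset.sum_add_distrib, ← Finset.sum_mul, sum_iid hPX, one_mul] at h
  linarith [sum_iid_mul_log_output_le hPX hpos hV hVsum c]

theorem abs_sub_le_tvDist {α : Type*} [Fintype α] (P Q : α → ℝ) (a : α) :
    |P a - Q a| ≤ tvDist P Q := by
  have := Finset.le_sup' (s := Finset.univ.powerset)
    (fun A : Finset α => |∑ a ∈ A, P a - ∑ a ∈ A, Q a|)
    (Finset.mem_powerset.mpr (Finset.subset_univ {a}))
  simpa [tvDist] using this

theorem IsPMF.le_one {α : Type*} [Fintype α] {P : α → ℝ} (hP : IsPMF P) (a : α) : P a ≤ 1 :=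
  hP.2 ▸ Finset.single_le_sum (fun b _ => hP.1 b) (Finset.mem_univ a)

theorem empDist_nonneg [DecidableEq X] [DecidableEq Y] {n : ℕ} (xs : Fin n → X) (ys : Fin n → Y)
    (p : X × Y) : 0 ≤ empDist xs ys p := by
  unfold empDist
  positivity

theorem empDist_le_one [DecidableEq X] [DecidableEq Y] {n : ℕ} (xs : Fin n → X) (ys : Fin n → Y)
    (p : X × Y) : empDist xs ys p ≤ 1 := by
  refine div_le_one_of_le₀ ?_ (Nat.cast_nonneg n)
  exact_mod_cast (Finset.card_le_univ _).trans_eq (Fintype.card_fin n)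

theorem sum_empDist_mul [Fintype X] [Fintype Y] [DecidableEq X] [DecidableEq Y] {n : ℕ}
    (xs : Fin n → X) (ys : Fin n → Y) (f : X × Y → ℝ) :
    ∑ p, empDist xs ys p * f p = (∑ i, f (xs i, ys i)) / n := by
  have h : ∀ p, empDist xs ys p * f p = ∑ i, (if (xs i, ys i) = p then f p else 0) / n := by
    intro p
    simp only [empDist, Finset.card_eq_sum_ones, Finset.sum_filter, Nat.cast_sum,
      Finset.sum_div, Finset.sum_mul, Prod.ext_iff]
    refine Finset.sum_congr rfl fun i _ => ?_
    split_ifs <;> simp [div_eq_inv_mul]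
  simp only [h]
  rw [Finset.sum_comm, Finset.sum_div]
  refine Finset.sum_congr rfl fun i _ => ?_
  rw [← Finset.sum_div]
  simp

/-- Convergence of the empirical distribution in probability implies convergence of the expected
empirical average of any function on the alphabet. -/
theorem TVInProb.tendsto_sum_iid [Fintype X] [Fintype Y] [DecidableEq X] [DecidableEq Y]
    {PX : X → ℝ} (hPX : IsPMF PX) (hpos : ∀ x, 0 < PX x) {PXY : X × Y → ℝ} (hPXY : IsPMF PXY)
    {c : ∀ n, Code X Y n} (hc : TVInProb PX PXY c) (f : X × Y → ℝ) :
    Tendsto (fun n => (∑ xs, iid PX n xs * ∑ i, f (xs i, (c n).out xs i)) / n)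
      atTop (nhds (∑ p, PXY p * f p)) := by
  set C : ℝ := ∑ p, |f p| with hC
  have hC0 : 0 ≤ C := Finset.sum_nonneg fun _ _ => abs_nonneg _
  have hbound : ∀ ε : ℝ, 0 < ε → ∀ n,
      |(∑ xs, iid PX n xs * ∑ i, f (xs i, (c n).out xs i)) / n - ∑ p, PXY p * f p| ≤
      C * (ε + ∑ xs : Fin n → X,
        if ε < tvDist (empDist xs ((c n).out xs)) PXY then iid PX n xs else 0) := by
    intro ε hε n
    have hdiff : (∑ xs, iid PX n xs * ∑ i, f (xs i, (c n).out xs i)) / n - ∑ p, PXY p * f p =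
        ∑ xs, iid PX n xs * ∑ p, (empDist xs ((c n).out xs) p - PXY p) * f p := by
      simp only [sub_mul, Finset.sum_sub_distrib, mul_sub, sum_empDist_mul]
      rw [← Finset.sum_mul, sum_iid hPX, one_mul, Finset.sum_div]
      simp only [mul_div_assoc]
    rw [hdiff]
    refine (Finset.abs_sum_le_sum_abs _ _).trans ?_
    have hterm : ∀ xs : Fin n → X,
        |iid PX n xs * ∑ p, (empDist xs ((c n).out xs) p - PXY p) * f p| ≤
        C * (ε * iid PX n xs +
          if ε < tvDist (empDist xs ((c n).out xs)) PXY then iid PX n xs else 0) := by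
      intro xs
      have hp := iid_pos hpos xs
      have hsum : ∀ b : ℝ, (∀ p, |empDist xs ((c n).out xs) p - PXY p| ≤ b) →
          |∑ p, (empDist xs ((c n).out xs) p - PXY p) * f p| ≤ b * C := by
        intro b hb
        refine (Finset.abs_sum_le_sum_abs _ _).trans ?_
        rw [hC, Finset.mul_sum]
        refine Finset.sum_le_sum fun p _ => ?_
        rw [abs_mul]
        exact mul_le_mul_of_nonneg_right (hb p) (abs_nonneg _)
      rw [abs_mul, abs_of_pos hp]
      split_ifs with h
      · have h1 := hsum 1 fun p => by
          rw [abs_le]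
          constructor <;> linarith [empDist_nonneg xs ((c n).out xs) p,
            empDist_le_one xs ((c n).out xs) p, hPXY.1 p, hPXY.le_one p]
        calc _ ≤ iid PX n xs * (1 * C) := mul_le_mul_of_nonneg_left h1 hp.le
          _ ≤ _ := by nlinarith [mul_nonneg hC0 (mul_nonneg hε.le hp.le)]
      · have h1 := hsum ε fun p => (abs_sub_le_tvDist _ _ p).trans (not_lt.mp h)
        calc _ ≤ iid PX n xs * (ε * C) := mul_le_mul_of_nonneg_left h1 hp.le
          _ = _ := by ring
    refine (Finset.sum_le_sum fun xs _ => hterm xs).trans_eq ?_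
    rw [← Finset.mul_sum, Finset.sum_add_distrib, ← Finset.mul_sum, sum_iid hPX, mul_one]
  rw [Metric.tendsto_nhds]
  intro δ hδ
  have hε : 0 < δ / (2 * (C + 1)) := by positivity
  filter_upwards [(hc _ hε).eventually (gt_mem_nhds hε)] with n hn
  rw [Real.dist_eq]
  refine (hbound _ hε n).trans_lt ?_
  calc _ ≤ C * (δ / (2 * (C + 1)) + δ / (2 * (C + 1))) := by gcongr
    _ = δ * (C / (C + 1)) := by field_simp; ring
    _ < δ * 1 := by
      refine mul_lt_mul_of_pos_left ?_ hδ
      rw [div_lt_one (by positivity)]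
      linarith
    _ = δ := mul_one δ

/-- Mixing the backward channel with the source law keeps it bounded away from zero at a cost of
at most `-log (1 - η)` in mutual information. -/
theorem mutualInfo_add_log_le [Fintype X] [Fintype Y] {PX : X → ℝ} (hpos : ∀ x, 0 < PX x)
    {PXY : X × Y → ℝ} (hPXY : IsPMF PXY) (hmarg : ∀ x, margX PXY x = PX x)
    {η : ℝ} (h0 : 0 < η) (h1 : η < 1) :
    mutualInfo PXY + Real.log (1 - η) ≤ ∑ p : X × Y, PXY p *
      Real.log (((1 - η) * condXY PXY p.1 p.2 + η * PX p.1) / PX p.1) := by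
  have hlog : Real.log (1 - η) = ∑ p, PXY p * Real.log (1 - η) := by
    rw [← Finset.sum_mul, hPXY.2, one_mul]
  rw [mutualInfo, ← Fintype.sum_prod_type' fun x y =>
    PXY (x, y) * Real.log (PXY (x, y) / (margX PXY x * margY PXY y)), hlog,
    ← Finset.sum_add_distrib]
  refine Finset.sum_le_sum fun p _ => ?_
  obtain ⟨x, y⟩ := p
  rcases (hPXY.1 (x, y)).eq_or_lt with h | h
  · simp [← h]
  have hx := hpos x
  have hy : 0 < margY PXY y := h.trans_le <|
    Finset.single_le_sum (f := fun x => PXY (x, y)) (fun x _ => hPXY.1 (x, y)) (Finset.mem_univ x)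
  have hη : 0 < 1 - η := by linarith
  rw [← mul_add, hmarg, ← Real.log_mul (by positivity) hη.ne']
  refine mul_le_mul_of_nonneg_left (Real.log_le_log (by positivity) ?_) h.le
  calc PXY (x, y) / (PX x * margY PXY y) * (1 - η)
      = (1 - η) * condXY PXY x y / PX x := by
        rw [condXY]
        field_simp
    _ ≤ _ := by
        gcongr
        have : 0 < η * PX x := by positivity
        linarith

end OutputRelativeEntropy

/-- For any good sequence of coordination codes for `P_{Y|X}`, the normalized relative
entropy between the true output distribution `P_{Yⁿ}` and the uniform distribution
`Q_{Yⁿ}` over the codebook vanishes. -/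
theorem good_coordination_codes_output_relEnt
    {X Y : Type*} [Fintype X] [Fintype Y] [DecidableEq X] [DecidableEq Y]
    (PX : X → ℝ) (hPX : IsPMF PX) (hPXfull : ∀ x, 0 < PX x)
    (W : X → Y → ℝ) (hW : ∀ x, IsPMF (W x))
    (PXY : X × Y → ℝ) (hPXY : ∀ x y, PXY (x, y) = PX x * W x y)
    (c : ∀ n, Code X Y n) (hgood : GoodCoord PX PXY c) :
    Tendsto
      (fun n =>
        relEnt (margY (inducedJoint PX (c n))) (codebookUniform (c n)) / (n : ℝ≥0∞))
      atTop (nhds 0) := by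
  have hPXYpmf : IsPMF PXY := by
    refine ⟨fun p => ?_, ?_⟩
    · rw [← Prod.mk.eta (p := p), hPXY]
      exact mul_nonneg (hPX.1 _) ((hW _).1 _)
    · rw [Fintype.sum_prod_type]
      simp only [hPXY, ← Finset.mul_sum, (hW _).2, mul_one, hPX.2]
  have hmarg : ∀ x, margX PXY x = PX x := fun x => by
    simp only [margX, hPXY, ← Finset.mul_sum, (hW x).2, mul_one]
  rw [ENNReal.tendsto_nhds_zero]
  intro ε hε
  obtain ⟨δ, hδ, hδε⟩ : ∃ δ : ℝ, 0 < δ ∧ ENNReal.ofReal δ ≤ ε := by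
    refine ⟨(min ε 1).toReal, ENNReal.toReal_pos (lt_min hε one_pos).ne' (by simp), ?_⟩
    rw [ENNReal.ofReal_toReal (by simp)]
    exact min_le_left _ _
  set η : ℝ := 1 - Real.exp (-(δ / 2)) with hη
  have hη0 : 0 < η := by
    have : Real.exp (-(δ / 2)) < 1 := Real.exp_lt_one_iff.mpr (by linarith)
    linarith
  have hη1 : η < 1 := by linarith [Real.exp_pos (-(δ / 2))]
  have hlogη : Real.log (1 - η) = -(δ / 2) := by simp [hη]
  set V : X → Y → ℝ := fun x y => (1 - η) * condXY PXY x y + η * PX x with hVdef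
  have hmargY : ∀ y, 0 ≤ margY PXY y := fun y => Finset.sum_nonneg fun x _ => hPXYpmf.1 _
  have hV : ∀ x y, 0 < V x y := fun x y =>
    add_pos_of_nonneg_of_pos
      (mul_nonneg (by linarith) (div_nonneg (hPXYpmf.1 _) (hmargY y)))
      (mul_pos hη0 (hPXfull x))
  have hVsum : ∀ y, ∑ x, V x y ≤ 1 := by
    intro y
    have hcond : ∑ x, condXY PXY x y ≤ 1 := by
      simp only [condXY, ← Finset.sum_div]
      exact div_self_le_one (margY PXY y)
    rw [hVdef, Finset.sum_add_distrib, ← Finset.mul_sum, ← Finset.mul_sum, hPX.2]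
    nlinarith
  have hlim := hgood.1.sub (hgood.2.tendsto_sum_iid hPX hPXfull hPXYpmf
    fun p => Real.log (V p.1 p.2 / PX p.1))
  have hlt : mutualInfo PXY - ∑ p, PXY p * Real.log (V p.1 p.2 / PX p.1) < δ := by
    have := mutualInfo_add_log_le hPXfull hPXYpmf hmarg hη0 hη1
    rw [hlogη] at this
    linarith
  filter_upwards [hlim.eventually (gt_mem_nhds hlt), eventually_gt_atTop 0] with n hn hn0
  have hnpos : (0 : ℝ) < n := by exact_mod_cast hn0
  refine le_trans ?_ hδε
  rw [relEnt_output_eq_ofReal, ← ENNReal.ofReal_natCast, ← ENNReal.ofReal_div_of_pos hnpos]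
  refine ENNReal.ofReal_le_ofReal (le_trans ?_ hn.le)
  rw [Code.rate, ← sub_div]
  exact div_le_div_of_nonneg_right (sum_iid_mul_log_div_le hPX hPXfull hV hVsum (c n)) hnpos.le
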